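/- Fix an integer d ≥ 2. The function H is differentiable on (0,∞) and satisfies the differential equation H′(z) = −(d/z)·H(z) − 2·G_1(z)·(d/2 + 1 − H(z)) for every z > 0. -/

import Mathlib

open MeasureTheory Real Filter

/-- The modified Bessel function of the second kind, defined via its integral
representation `K_ν(z) = ∫_0^∞ exp(−z cosh t) cosh(ν t) dt`. -/
noncomputable def besselK (ν z : ℝ) : ℝ :=
  ∫ t in Set.Ioi (0:ℝ), Real.exp (-z * Real.cosh t) * Real.cosh (ν * t)

/-- The ratio `G_k(z) = K_{(d+1)/2+k}(z) / K_{(d+1)/2}(z)`. -/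
noncomputable def G (d k : ℤ) (z : ℝ) : ℝ :=
  besselK (((d : ℝ) + 1) / 2 + (k : ℝ)) z / besselK (((d : ℝ) + 1) / 2) z

/-- `H(z) = −z² G_1′(z)`; physically `H(z) = c_p/k_B` is the dimensionless heat
capacity per particle at constant pressure, and `H(z) − 1 = c_v/k_B`. -/
noncomputable def Hfun (d : ℤ) (z : ℝ) : ℝ := -z ^ 2 * deriv (G d 1) z

theorem cosh_mul_le_exp_abs_mul (μ : ℝ) {t : ℝ} (ht : 0 ≤ t) :
    Real.cosh (μ * t) ≤ Real.exp (|μ| * t) := by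
  rw [← Real.cosh_abs, abs_mul, abs_of_nonneg ht, Real.cosh_eq]
  have h : Real.exp (-(|μ| * t)) ≤ Real.exp (|μ| * t) :=
    Real.exp_le_exp.mpr (by have := mul_nonneg (abs_nonneg μ) ht; linarith)
  linarith

theorem half_sq_le_cosh {t : ℝ} (ht : 0 ≤ t) : t ^ 2 / 2 ≤ Real.cosh t := by
  have h'' := Real.cosh_sq (t / 2)
  have h3 := Real.cosh_two_mul (t / 2)
  have h4 : t / 2 ≤ Real.sinh (t / 2) := Real.self_le_sinh_iff.mpr (by linarith)
  rw [show 2 * (t / 2) = t by ring] at h3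
  nlinarith

/-- The Bessel kernel decays at least exponentially. -/
theorem exp_neg_mul_cosh_mul_cosh_le (μ : ℝ) {z t : ℝ} (hz : 0 < z) (ht : 0 ≤ t) :
    Real.exp (-z * Real.cosh t) * Real.cosh (μ * t) ≤
      Real.exp ((|μ| + 1) ^ 2 / (2 * z)) * Real.exp (-t) := by
  refine (mul_le_mul_of_nonneg_left (cosh_mul_le_exp_abs_mul μ ht) (Real.exp_pos _).le).trans ?_
  rw [← Real.exp_add, ← Real.exp_add]
  apply Real.exp_le_exp.mpr
  have h := mul_le_mul_of_nonneg_left (half_sq_le_cosh ht) hz.le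
  have hsq : (|μ| + 1) ^ 2 / (2 * z) - (|μ| + 1) * t + z * (t ^ 2 / 2) =
      (|μ| + 1 - z * t) ^ 2 / (2 * z) := by
    field_simp
    ring
  have : 0 ≤ (|μ| + 1 - z * t) ^ 2 / (2 * z) := by positivity
  linarith

theorem integrableOn_besselK (μ : ℝ) {z : ℝ} (hz : 0 < z) :
    IntegrableOn (fun t => Real.exp (-z * Real.cosh t) * Real.cosh (μ * t)) (Set.Ioi 0) := by
  refine Integrable.mono' ((integrableOn_exp_neg_Ioi 0).const_mul
    (Real.exp ((|μ| + 1) ^ 2 / (2 * z))))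
    (Continuous.aestronglyMeasurable (by fun_prop)) ?_
  filter_upwards [ae_restrict_mem measurableSet_Ioi] with t ht
  rw [Real.norm_of_nonneg (mul_pos (Real.exp_pos _) (Real.cosh_pos _)).le]
  exact exp_neg_mul_cosh_mul_cosh_le μ hz (le_of_lt ht)

theorem cosh_mul_cosh_mul (ν t : ℝ) : Real.cosh t * Real.cosh (ν * t) =
    (Real.cosh ((ν + 1) * t) + Real.cosh ((ν - 1) * t)) / 2 := by
  rw [add_mul, sub_mul, one_mul, Real.cosh_add, Real.cosh_sub]
  ring

theorem sinh_mul_sinh_mul (ν t : ℝ) : Real.sinh t * Real.sinh (ν * t) =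
    (Real.cosh ((ν + 1) * t) - Real.cosh ((ν - 1) * t)) / 2 := by
  rw [add_mul, sub_mul, one_mul, Real.cosh_add, Real.cosh_sub]
  ring

theorem besselK_pos (ν : ℝ) {z : ℝ} (hz : 0 < z) : 0 < besselK ν z := by
  have hpos : ∀ t, 0 < Real.exp (-z * Real.cosh t) * Real.cosh (ν * t) :=
    fun t => mul_pos (Real.exp_pos _) (Real.cosh_pos _)
  unfold besselK
  rw [integral_pos_iff_support_of_nonneg (fun t => (hpos t).le) (integrableOn_besselK ν hz)]
  have : Function.support (fun t => Real.exp (-z * Real.cosh t) * Real.cosh (ν * t)) = Set.univ :=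
    Set.eq_univ_of_forall fun t => (hpos t).ne'
  rw [this]
  simp

theorem hasDerivAt_besselK_half (ν : ℝ) {z : ℝ} (hz : 0 < z) :
    HasDerivAt (besselK ν) (-(besselK (ν + 1) z + besselK (ν - 1) z) / 2) z := by
  have hz2 : 0 < z / 2 := by linarith
  have hint : ∀ {x : ℝ}, 0 < x → IntegrableOn
      (fun t => Real.exp (-x * Real.cosh t) * (Real.cosh t * Real.cosh (ν * t))) (Set.Ioi 0) := by
    intro x hx
    refine (((integrableOn_besselK (ν + 1) hx).add
      (integrableOn_besselK (ν - 1) hx)).div_const 2).congr (ae_of_all _ fun t => ?_)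
    simp only [Pi.add_apply, cosh_mul_cosh_mul]
    ring
  have key := (hasDerivAt_integral_of_dominated_loc_of_deriv_le
    (μ := volume.restrict (Set.Ioi (0 : ℝ)))
    (F := fun x t => Real.exp (-x * Real.cosh t) * Real.cosh (ν * t))
    (F' := fun x t => -(Real.exp (-x * Real.cosh t) * (Real.cosh t * Real.cosh (ν * t))))
    (bound := fun t => Real.exp (-(z / 2) * Real.cosh t) * (Real.cosh t * Real.cosh (ν * t)))
    (x₀ := z) (Ioi_mem_nhds (show z / 2 < z by linarith))
    (Eventually.of_forall fun x => Continuous.aestronglyMeasurable (by fun_prop))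
    (integrableOn_besselK ν hz)
    (Continuous.aestronglyMeasurable (by fun_prop))
    (ae_of_all _ fun t x hx => by
      have h := mul_pos (Real.cosh_pos t) (Real.cosh_pos (ν * t))
      rw [norm_neg, Real.norm_of_nonneg (mul_pos (Real.exp_pos _) h).le]
      refine mul_le_mul_of_nonneg_right (Real.exp_le_exp.mpr ?_) h.le
      have hx' : z / 2 < x := hx
      nlinarith [Real.cosh_pos t])
    (hint hz2)
    (ae_of_all _ fun t x _ => by
      have h := (((hasDerivAt_id x).neg.mul_const (Real.cosh t)).exp).mul_const (Real.cosh (ν * t))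
      refine h.congr_deriv ?_
      simp only [id, Pi.neg_apply]
      ring)).2
  refine key.congr_deriv ?_
  unfold besselK
  rw [← integral_add (integrableOn_besselK _ hz) (integrableOn_besselK _ hz), ← integral_neg,
    ← integral_div]
  refine integral_congr_ae (ae_of_all _ fun t => ?_)
  simp only [cosh_mul_cosh_mul]
  ring

/-- The three-term recurrence in the order. -/
theorem besselK_add_one_sub_besselK_sub_one (ν : ℝ) {z : ℝ} (hz : 0 < z) :
    z * (besselK (ν + 1) z - besselK (ν - 1) z) = 2 * ν * besselK ν z := by
  have hderiv : ∀ t, HasDerivAt (fun t => Real.exp (-z * Real.cosh t) * Real.sinh (ν * t))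
      (ν * (Real.exp (-z * Real.cosh t) * Real.cosh (ν * t)) -
        z / 2 * (Real.exp (-z * Real.cosh t) * Real.cosh ((ν + 1) * t) -
          Real.exp (-z * Real.cosh t) * Real.cosh ((ν - 1) * t))) t := by
    intro t
    have h := (((Real.hasDerivAt_cosh t).const_mul (-z)).exp).mul
      (((hasDerivAt_id t).const_mul ν).sinh)
    refine h.congr_deriv ?_
    simp only [id]
    linear_combination (-z) * Real.exp (-z * Real.cosh t) * sinh_mul_sinh_mul ν t
  have hlim : Tendsto (fun t => Real.exp (-z * Real.cosh t) * Real.sinh (ν * t)) atTop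
      (nhds 0) := by
    have h0 : Tendsto (fun t => Real.exp ((|ν| + 1) ^ 2 / (2 * z)) * Real.exp (-t)) atTop
        (nhds 0) := by
      simpa using Real.tendsto_exp_neg_atTop_nhds_zero.const_mul
        (Real.exp ((|ν| + 1) ^ 2 / (2 * z)))
    refine squeeze_zero_norm' ?_ h0
    filter_upwards [eventually_ge_atTop 0] with t ht
    refine le_trans ?_ (exp_neg_mul_cosh_mul_cosh_le ν hz ht)
    rw [norm_mul, Real.norm_of_nonneg (Real.exp_pos _).le]
    refine mul_le_mul_of_nonneg_left ?_ (Real.exp_pos _).le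
    rw [Real.norm_eq_abs]
    exact abs_le_of_sq_le_sq (by rw [Real.cosh_sq]; linarith) (Real.cosh_pos _).le
  have i0 := integrableOn_besselK ν hz
  have i1 := integrableOn_besselK (ν + 1) hz
  have i2 := integrableOn_besselK (ν - 1) hz
  have h := integral_Ioi_of_hasDerivAt_of_tendsto' (a := 0) (fun t _ => hderiv t)
    ((i0.const_mul ν).sub ((i1.sub i2).const_mul (z / 2))) hlim
  have h12 := integral_sub i1 i2
  have hsplit := integral_sub (i0.const_mul ν) ((i1.sub i2).const_mul (z / 2))
  simp only [Pi.sub_apply, integral_const_mul] at hsplit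
  rw [h12] at hsplit
  rw [hsplit] at h
  simp only [mul_zero, Real.sinh_zero, sub_zero] at h
  change ν * besselK ν z - z / 2 * (besselK (ν + 1) z - besselK (ν - 1) z) = 0 at h
  linarith

theorem hasDerivAt_besselK (ν : ℝ) {z : ℝ} (hz : 0 < z) :
    HasDerivAt (besselK ν) (ν / z * besselK ν z - besselK (ν + 1) z) z := by
  refine (hasDerivAt_besselK_half ν hz).congr_deriv ?_
  have h := besselK_add_one_sub_besselK_sub_one ν hz
  field_simp
  linarith

theorem hasDerivAt_besselK_add_one (ν : ℝ) {z : ℝ} (hz : 0 < z) :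
    HasDerivAt (besselK (ν + 1)) (-besselK ν z - (ν + 1) / z * besselK (ν + 1) z) z := by
  refine (hasDerivAt_besselK_half (ν + 1) hz).congr_deriv ?_
  have h := besselK_add_one_sub_besselK_sub_one (ν + 1) hz
  rw [add_sub_cancel_right] at h ⊢
  field_simp
  linarith

/-- The Riccati equation for `G_1`. -/
theorem hasDerivAt_G_one (d : ℤ) {z : ℝ} (hz : 0 < z) :
    HasDerivAt (G d 1) (G d 1 z ^ 2 - ((d : ℝ) + 2) / z * G d 1 z - 1) z := by
  have hG : G d 1 = fun z => besselK (((d : ℝ) + 1) / 2 + 1) z / besselK (((d : ℝ) + 1) / 2) z := by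
    funext z
    simp [G]
  have hK := (besselK_pos (((d : ℝ) + 1) / 2) hz).ne'
  rw [hG]
  refine ((hasDerivAt_besselK_add_one _ hz).div (hasDerivAt_besselK _ hz) hK).congr_deriv ?_
  field_simp
  ring

theorem Hfun_eq (d : ℤ) {z : ℝ} (hz : 0 < z) :
    Hfun d z = -z ^ 2 * (G d 1 z ^ 2 - ((d : ℝ) + 2) / z * G d 1 z - 1) := by
  rw [Hfun, (hasDerivAt_G_one d hz).deriv]

/-- `H` is differentiable on `(0,∞)` and satisfies
`H′(z) = −(d/z) H(z) − 2 G_1(z) (d/2 + 1 − H(z))`. -/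
theorem Hfun_hasDerivAt (d : ℤ) (hd : 2 ≤ d) (z : ℝ) (hz : 0 < z) :
    HasDerivAt (Hfun d)
      (-((d : ℝ) / z) * Hfun d z - 2 * G d 1 z * ((d : ℝ) / 2 + 1 - Hfun d z)) z := by
  have hG := hasDerivAt_G_one d hz
  have hev : Hfun d =ᶠ[nhds z]
      fun x => -(x ^ 2 * G d 1 x ^ 2) + ((d : ℝ) + 2) * (x * G d 1 x) + x ^ 2 := by
    filter_upwards [Ioi_mem_nhds hz] with x hx
    have hx0 : x ≠ 0 := (Set.mem_Ioi.mp hx).ne'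
    rw [Hfun_eq d hx]
    field_simp
    ring
  have h := ((((hasDerivAt_pow 2 z).mul (hG.pow 2)).neg).add
    (((hasDerivAt_id z).mul hG).const_mul ((d : ℝ) + 2))).add (hasDerivAt_pow 2 z)
  refine (h.congr_of_eventuallyEq hev).congr_deriv ?_
  rw [Hfun_eq d hz]
  simp only [id, Pi.pow_apply]
  field_simp
  push_cast
  ring
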